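/- For each dyadic interval I = [l·2^k, (l+1)·2^k) ⊂ [0,∞) and any x_I ∈ I, the Walsh transform of its indicator satisfies F_W(1_I)(y) = |I| · 1_{[0,|I|^{-1}]}(y) · e_W(x_I ⊗ y) for almost every y ≥ 0. -/

import Mathlib

open MeasureTheory Set

noncomputable section

/-- The binary digit of `x ≥ 0` in position `k` (the coefficient of `2^k` in the binary
expansion `x = ∑_k x_k 2^k`). -/
def rbit (x : ℝ) (k : ℤ) : ℕ := (⌊x / (2:ℝ) ^ k⌋ % 2).toNat

/-- The `k`-th binary digit of the dyadic convolution product: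
`c_k = ∑_{j ∈ ℤ} x_j y_{k-j} (mod 2)` (the sum is always finite). -/
def dprodDigit (x y : ℝ) (k : ℤ) : ℕ :=
  {j : ℤ | rbit x j = 1 ∧ rbit y (k - j) = 1}.ncard % 2

/-- The dyadic convolution product `x ⊗ y := ∑_k c_k 2^k`. -/
def dprod (x y : ℝ) : ℝ := ∑' k : ℤ, (dprodDigit x y k : ℝ) * (2:ℝ) ^ k

/-- The Walsh exponential `e_W(x) = (-1)^{x_{-1}}`, where `x_{-1}` is the first binary
digit of `x` after the point. -/
def eW (x : ℝ) : ℝ := (-1 : ℝ) ^ rbit x (-1)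

/-- The Walsh transform `F_W f(y) = ∫_{[0,∞)} e_W(x ⊗ y) f(x) dx`. -/
def walshTransform (f : ℝ → ℂ) (y : ℝ) : ℂ :=
  ∫ x in Set.Ici (0:ℝ), (eW (dprod x y) : ℂ) * f x

/-- `x` is a dyadic rational. -/
def IsDyadic (x : ℝ) : Prop := ∃ (n : ℤ) (k : ℕ), x = (n : ℝ) / 2 ^ k

theorem floor_div_zpow_succ (x : ℝ) (i : ℤ) :
    ⌊x / (2:ℝ) ^ (i + 1)⌋ = ⌊x / (2:ℝ) ^ i⌋ / 2 := by
  have h := Int.floor_div_natCast (x / (2:ℝ) ^ i) 2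
  rw [zpow_add_one₀ (two_ne_zero), ← div_div]
  exact_mod_cast h

theorem rbit_eq_one_iff (x : ℝ) (i : ℤ) : rbit x i = 1 ↔ ⌊x / (2:ℝ) ^ i⌋ % 2 = 1 := by
  unfold rbit
  omega

theorem floor_div_zpow_eq_zero {x : ℝ} (hx : 0 ≤ x) {n i : ℤ} (hn : x < 2 ^ n) (hi : n ≤ i) :
    ⌊x / (2:ℝ) ^ i⌋ = 0 := by
  rw [Int.floor_eq_zero_iff, mem_Ico]
  refine ⟨by positivity, ?_⟩
  rw [div_lt_one (by positivity)]
  exact hn.trans_le (zpow_le_zpow_right₀ (by norm_num) hi)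

theorem rbit_eq_zero_of_lt_zpow {x : ℝ} (hx : 0 ≤ x) {n i : ℤ} (hn : x < 2 ^ n) (hi : n ≤ i) :
    rbit x i = 0 := by
  simp [rbit, floor_div_zpow_eq_zero hx hn hi]

theorem exists_lt_two_zpow (x : ℝ) : ∃ n : ℤ, x < (2:ℝ) ^ n := by
  obtain ⟨n, hn⟩ := pow_unbounded_of_one_lt x (one_lt_two : (1:ℝ) < 2)
  exact ⟨n, by exact_mod_cast hn⟩

/-- The leading binary digit of a positive real. -/
theorem exists_leading_rbit {x : ℝ} (hx : 0 < x) :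
    ∃ n : ℤ, x < (2:ℝ) ^ (n + 1) ∧ (2:ℝ) ^ n ≤ x ∧ rbit x n = 1 := by
  obtain ⟨n, hn1, hn2⟩ := exists_mem_Ico_zpow hx (one_lt_two : (1:ℝ) < 2)
  refine ⟨n, hn2, hn1, ?_⟩
  have : ⌊x / (2:ℝ) ^ n⌋ = 1 := by
    rw [Int.floor_eq_iff]
    rw [zpow_add_one₀ two_ne_zero] at hn2
    constructor
    · rw [le_div_iff₀ (by positivity)]; simpa using hn1
    · rw [div_lt_iff₀ (by positivity)]; push_cast; linarith
  rw [rbit_eq_one_iff, this]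
  norm_num

theorem finite_dprodDigit_set {x y : ℝ} (hx : 0 ≤ x) (hy : 0 ≤ y) (k : ℤ) :
    {j : ℤ | rbit x j = 1 ∧ rbit y (k - j) = 1}.Finite := by
  obtain ⟨n, hn⟩ := exists_lt_two_zpow x
  obtain ⟨m, hm⟩ := exists_lt_two_zpow y
  refine (Set.finite_Icc (k - m) n).subset ?_
  rintro j ⟨h1, h2⟩
  constructor
  · by_contra! h
    have := rbit_eq_zero_of_lt_zpow hy hm (i := k - j) (by omega)
    omega
  · by_contra! h
    have := rbit_eq_zero_of_lt_zpow hx hn (i := j) (by omega)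
    omega

theorem dprodDigit_comm (x y : ℝ) (k : ℤ) : dprodDigit x y k = dprodDigit y x k := by
  unfold dprodDigit
  have : {j : ℤ | rbit y j = 1 ∧ rbit x (k - j) = 1} =
      (fun j => k - j) '' {j : ℤ | rbit x j = 1 ∧ rbit y (k - j) = 1} := by
    ext j
    constructor
    · rintro ⟨h1, h2⟩
      exact ⟨k - j, ⟨h2, by simpa using h1⟩, by simp⟩
    · rintro ⟨i, ⟨h1, h2⟩, rfl⟩
      exact ⟨h2, by simpa using h1⟩
  rw [this, Set.ncard_image_of_injective _ (fun a b h => by simpa using h)]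

theorem dprodDigit_zero_left (y : ℝ) (k : ℤ) : dprodDigit 0 y k = 0 := by
  simp [dprodDigit, rbit]

theorem dprodDigit_le_one (x y : ℝ) (k : ℤ) : dprodDigit x y k ≤ 1 := by
  unfold dprodDigit
  omega

theorem exists_dprodDigit_eq_zero {x y : ℝ} (hx : 0 ≤ x) (hy : 0 ≤ y) :
    ∃ N : ℤ, ∀ k, N ≤ k → dprodDigit x y k = 0 := by
  obtain ⟨n, hn⟩ := exists_lt_two_zpow x
  obtain ⟨m, hm⟩ := exists_lt_two_zpow y
  refine ⟨n + m, fun k hk => ?_⟩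
  have : {j : ℤ | rbit x j = 1 ∧ rbit y (k - j) = 1} = ∅ := by
    ext j
    simp only [mem_ofPred_eq, mem_empty_iff_false, iff_false, not_and]
    intro h1 h2
    rcases le_total n j with h | h
    · have := rbit_eq_zero_of_lt_zpow hx hn h
      omega
    · have := rbit_eq_zero_of_lt_zpow hy hm (i := k - j) (by omega)
      omega
  simp [dprodDigit, this]

theorem hasSum_two_zpow_neg : HasSum (fun n : ℕ => (2:ℝ) ^ (-((n : ℤ) + 1))) 1 := by
  convert hasSum_geometric_two' 1 using 2 with n
  rw [zpow_neg, zpow_add_one₀ two_ne_zero, zpow_natCast, mul_inv, div_eq_mul_inv, one_div,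
    mul_comm]

/-- The integer part of a binary series whose fractional digits are not all `1` has the parity of
its unit digit. -/
theorem floor_tsum_digits_emod_two (d : ℤ → ℕ) (hd : ∀ k, d k ≤ 1)
    (hN : ∃ N : ℤ, ∀ k, N ≤ k → d k = 0) (h0 : ∃ k < 0, d k = 0) :
    ⌊∑' k : ℤ, (d k : ℝ) * (2:ℝ) ^ k⌋ % 2 = d 0 := by
  obtain ⟨N, hN⟩ := hN
  obtain ⟨k₀, hk₀, hdk₀⟩ := h0
  have hupper : HasSum (fun n : ℕ => (d n : ℝ) * (2:ℝ) ^ (n : ℤ))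
      (∑ n ∈ Finset.range (N.toNat + 1), (d n : ℝ) * (2:ℝ) ^ (n : ℤ)) := by
    apply hasSum_sum_of_ne_finset_zero
    intro n hn
    rw [Finset.mem_range] at hn
    rw [hN n (by omega)]
    simp
  have hle : ∀ n : ℕ, (d (-((n : ℤ) + 1)) : ℝ) * (2:ℝ) ^ (-((n : ℤ) + 1)) ≤
      (2:ℝ) ^ (-((n : ℤ) + 1)) := fun n =>
    mul_le_of_le_one_left (by positivity) (by exact_mod_cast hd _)
  have hsum : Summable fun n : ℕ => (d (-((n : ℤ) + 1)) : ℝ) * (2:ℝ) ^ (-((n : ℤ) + 1)) :=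
    Summable.of_nonneg_of_le (fun n => by positivity) hle hasSum_two_zpow_neg.summable
  have hlt : ∑' n : ℕ, (d (-((n : ℤ) + 1)) : ℝ) * (2:ℝ) ^ (-((n : ℤ) + 1)) < 1 := by
    rw [← hasSum_two_zpow_neg.tsum_eq]
    refine hsum.tsum_lt_tsum (i := (-k₀ - 1).toNat) hle ?_ hasSum_two_zpow_neg.summable
    have : -((((-k₀ - 1).toNat : ℕ) : ℤ) + 1) = k₀ := by omega
    rw [this, hdk₀]
    simp only [Nat.cast_zero, zero_mul]
    positivity
  have hnonneg : 0 ≤ ∑' n : ℕ, (d (-((n : ℤ) + 1)) : ℝ) * (2:ℝ) ^ (-((n : ℤ) + 1)) :=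
    tsum_nonneg fun n => by positivity
  have hall := HasSum.of_nat_of_neg_add_one (f := fun k : ℤ => (d k : ℝ) * (2:ℝ) ^ k) hupper
    hsum.hasSum
  rw [hall.tsum_eq, Finset.sum_range_succ']
  have hcast : (∑ n ∈ Finset.range N.toNat, (d ((n + 1 : ℕ) : ℤ) : ℝ) * (2:ℝ) ^ ((n + 1 : ℕ) : ℤ))
      + (d ((0 : ℕ) : ℤ) : ℝ) * (2:ℝ) ^ ((0 : ℕ) : ℤ) =
      ((2 * ∑ n ∈ Finset.range N.toNat, (d ((n + 1 : ℕ) : ℤ) : ℤ) * 2 ^ n + d 0 : ℤ) : ℝ) := by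
    push_cast
    rw [Finset.mul_sum]
    congr 1
    · refine Finset.sum_congr rfl fun n _ => ?_
      rw [zpow_add_one₀ two_ne_zero, zpow_natCast]
      ring
    · simp
  rw [hcast, Int.floor_intCast_add, Int.floor_eq_zero_iff.2 ⟨hnonneg, hlt⟩]
  have hd0 := hd 0
  omega

theorem rbit_dprod {x y : ℝ} (hx : 0 ≤ x) (hy : 0 ≤ y) (n : ℤ)
    (h : ∃ k < n, dprodDigit x y k = 0) : rbit (dprod x y) n = dprodDigit x y n := by
  have hshift : dprod x y / (2:ℝ) ^ n = ∑' k : ℤ, (dprodDigit x y (k + n) : ℝ) * (2:ℝ) ^ k := by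
    rw [dprod, ← tsum_div_const, ← (Equiv.addRight n).tsum_eq]
    refine tsum_congr fun k => ?_
    rw [Equiv.coe_addRight, zpow_add₀ two_ne_zero]
    field_simp
  obtain ⟨N, hN⟩ := exists_dprodDigit_eq_zero hx hy
  obtain ⟨k, hk, hk0⟩ := h
  have := floor_tsum_digits_emod_two (fun k => dprodDigit x y (k + n))
    (fun k => dprodDigit_le_one x y _) ⟨N - n, fun k hk => hN _ (by omega)⟩
    ⟨k - n, by omega, by simpa using hk0⟩
  rw [rbit, hshift, this]
  simp

theorem eq_of_forall_floor_eq {y z : ℝ} (M : ℤ)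
    (h : ∀ n : ℕ, ⌊y / (2:ℝ) ^ (M - n)⌋ = ⌊z / (2:ℝ) ^ (M - n)⌋) : y = z := by
  by_contra hne
  have hpos : 0 < |y - z| := abs_pos.2 (sub_ne_zero.2 hne)
  obtain ⟨n, hn⟩ := pow_unbounded_of_one_lt ((2:ℝ) ^ M / |y - z|) (one_lt_two : (1:ℝ) < 2)
  have hlt := Int.abs_sub_lt_one_of_floor_eq_floor (h n)
  rw [← sub_div, abs_div, abs_of_pos (by positivity : (0:ℝ) < 2 ^ (M - n)),
    div_lt_one (by positivity), zpow_sub₀ two_ne_zero, zpow_natCast,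
    lt_div_iff₀ (by positivity)] at hlt
  rw [div_lt_iff₀ hpos] at hn
  linarith

theorem dprodDigit_ne_of_insert {x y x' y' : ℝ} {k k' j : ℤ}
    (hfin : {i : ℤ | rbit x i = 1 ∧ rbit y (k - i) = 1}.Finite)
    (hj : j ∉ {i : ℤ | rbit x i = 1 ∧ rbit y (k - i) = 1})
    (h : {i : ℤ | rbit x' i = 1 ∧ rbit y' (k' - i) = 1} =
      insert j {i : ℤ | rbit x i = 1 ∧ rbit y (k - i) = 1}) :
    dprodDigit x' y' k' + dprodDigit x y k = 1 := by
  unfold dprodDigit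
  rw [h, Set.ncard_insert_of_notMem hj hfin]
  omega

theorem dprodDigit_add_eq_one {x y z : ℝ} {k j : ℤ} (hx : 0 ≤ x) (hy : 0 ≤ y)
    (hxj : rbit x j = 1) (hyj : rbit y (k - j) ≠ 1) (hzj : rbit z (k - j) = 1)
    (h : ∀ i, i ≠ j → rbit x i = 1 → rbit y (k - i) = rbit z (k - i)) :
    dprodDigit x z k + dprodDigit x y k = 1 := by
  refine dprodDigit_ne_of_insert (j := j) (finite_dprodDigit_set hx hy k) (fun hj => hyj hj.2) ?_
  ext i
  rw [mem_insert_iff]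
  by_cases hij : i = j
  · subst hij
    simp [hxj, hzj]
  · simp only [mem_ofPred_eq, hij, false_or]
    refine and_congr_right fun hi => ?_
    rw [h i hij hi]

theorem countable_dprodDigit_eq_one {x : ℝ} (hx : 0 ≤ x) (K : ℤ) :
    {y : ℝ | 0 ≤ y ∧ ∀ k < K, dprodDigit x y k = 1}.Countable := by
  rcases hx.eq_or_lt with rfl | hpos
  · refine Set.countable_empty.mono ?_
    rintro y ⟨-, h⟩
    have := h (K - 1) (by omega)
    rw [dprodDigit_zero_left] at this
    omega
  obtain ⟨j, hj, -, hxj⟩ := exists_leading_rbit hpos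
  refine Set.MapsTo.countable_of_injOn (f := fun y : ℝ => ⌊y / (2:ℝ) ^ (K - j)⌋)
    (t := Set.univ) (fun _ _ => mem_univ _) ?_ (Set.to_countable _)
  rintro y ⟨hy, hyK⟩ z ⟨hz, hzK⟩ hyz
  have key : ∀ n : ℕ, ∀ i, K - j - n ≤ i → ⌊y / (2:ℝ) ^ i⌋ = ⌊z / (2:ℝ) ^ i⌋ := by
    intro n
    induction n with
    | zero =>
      intro i hi
      have hi' : K - j ≤ i := by simpa using hi
      induction i, hi' using Int.leInduction with
      | base => exact hyz
      | succ i hi' ih =>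
        rw [floor_div_zpow_succ, floor_div_zpow_succ, ih (by simpa using hi')]
    | succ n ih =>
      intro i hi
      push_cast at hi
      rcases eq_or_lt_of_le hi with hi | hi
      swap
      · exact ih i (by omega)
      have hy1 := hyK (i + j) (by omega)
      have hz1 := hzK (i + j) (by omega)
      have hbits : ∀ a, a ≠ j → rbit x a = 1 → rbit y (i + j - a) = rbit z (i + j - a) := by
        intro a ha hxa
        have haj : a < j := by
          by_contra! hja
          have := rbit_eq_zero_of_lt_zpow hx hj (i := a) (by omega)
          omega
        unfold rbit
        rw [ih _ (by omega)]
      have hup : ⌊y / (2:ℝ) ^ (i + 1)⌋ = ⌊z / (2:ℝ) ^ (i + 1)⌋ := ih _ (by omega)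
      rw [floor_div_zpow_succ, floor_div_zpow_succ] at hup
      have hbit : rbit y i = 1 ↔ rbit z i = 1 := by
        have hi' : i = i + j - j := by omega
        constructor
        · intro h
          by_contra h'
          rw [hi'] at h h'
          have := dprodDigit_add_eq_one hx hz hxj h' h fun a ha hxa => (hbits a ha hxa).symm
          omega
        · intro h
          by_contra h'
          rw [hi'] at h h'
          have := dprodDigit_add_eq_one hx hy hxj h' h hbits
          omega
      rw [rbit_eq_one_iff, rbit_eq_one_iff] at hbit
      omega
  exact eq_of_forall_floor_eq (K - j) fun n => key n _ le_rfl

theorem eW_dprod {x y : ℝ} (hx : 0 ≤ x) (hy : 0 ≤ y) (h : ¬ ∀ k < -1, dprodDigit x y k = 1) :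
    eW (dprod x y) = (-1) ^ dprodDigit x y (-1) := by
  push Not at h
  obtain ⟨k, hk, hk1⟩ := h
  have := dprodDigit_le_one x y k
  rw [eW, rbit_dprod hx hy _ ⟨k, hk, by omega⟩]

theorem ae_eW_dprod {y : ℝ} (hy : 0 ≤ y) :
    ∀ᵐ x : ℝ, 0 ≤ x → eW (dprod x y) = (-1) ^ dprodDigit x y (-1) := by
  filter_upwards [(countable_dprodDigit_eq_one hy (-1)).ae_notMem volume] with x hx hx0
  refine eW_dprod hx0 hy fun h => hx ⟨hx0, fun k hk => ?_⟩
  rw [dprodDigit_comm, h k hk]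

theorem mem_dyadic_Ico_iff (l : ℕ) (k : ℤ) (x : ℝ) :
    x ∈ Set.Ico ((l : ℝ) * 2 ^ k) ((l + 1 : ℝ) * 2 ^ k) ↔ ⌊x / (2:ℝ) ^ k⌋ = l := by
  rw [Int.floor_eq_iff, mem_Ico, le_div_iff₀ (by positivity), div_lt_iff₀ (by positivity)]
  simp

theorem floor_add_zpow_div_self (x : ℝ) (j : ℤ) :
    ⌊(x + 2 ^ j) / (2:ℝ) ^ j⌋ = ⌊x / (2:ℝ) ^ j⌋ + 1 := by
  rw [add_div, div_self (by positivity), Int.floor_add_one]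

theorem floor_add_zpow_div_of_lt {x : ℝ} {i j : ℤ} (hx : ⌊x / (2:ℝ) ^ j⌋ % 2 = 0) (hij : j < i) :
    ⌊(x + 2 ^ j) / (2:ℝ) ^ i⌋ = ⌊x / (2:ℝ) ^ i⌋ := by
  have hij' : j + 1 ≤ i := hij
  induction i, hij' using Int.leInduction with
  | base =>
    rw [floor_div_zpow_succ, floor_div_zpow_succ, floor_add_zpow_div_self]
    omega
  | succ i hi ih => rw [floor_div_zpow_succ, floor_div_zpow_succ, ih hi]

/-- Adding `2 ^ j` to a number whose `j`-th digit is `0` leaves the other digits unchanged. -/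
theorem rbit_add_zpow {x : ℝ} {i j : ℤ} (hx : ⌊x / (2:ℝ) ^ j⌋ % 2 = 0) (hij : i ≠ j) :
    rbit (x + 2 ^ j) i = rbit x i := by
  unfold rbit
  rcases lt_or_gt_of_ne hij with h | h
  · obtain ⟨n, rfl⟩ : ∃ n : ℕ, j = i + 1 + n := ⟨(j - i - 1).toNat, by omega⟩
    have : (x + 2 ^ (i + 1 + (n : ℤ))) / (2:ℝ) ^ i = x / 2 ^ i + ((2 * 2 ^ n : ℤ) : ℝ) := by
      rw [zpow_add₀ two_ne_zero, zpow_add_one₀ two_ne_zero, zpow_natCast]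
      push_cast
      field_simp
    rw [this, Int.floor_add_intCast]
    congr 1
    omega
  · rw [floor_add_zpow_div_of_lt hx h]

theorem dprodDigit_add_zpow {x y : ℝ} {j k : ℤ} (hx : 0 ≤ x) (hy : 0 ≤ y)
    (hxj : ⌊x / (2:ℝ) ^ j⌋ % 2 = 0) (hyj : rbit y (k - j) = 1) :
    dprodDigit (x + 2 ^ j) y k + dprodDigit x y k = 1 := by
  rw [dprodDigit_comm _ y, dprodDigit_comm x]
  refine dprodDigit_add_eq_one (j := k - j) hy hx hyj ?_ ?_ fun i hi _ => ?_
  · rw [sub_sub_cancel, Ne, rbit_eq_one_iff]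
    omega
  · rw [sub_sub_cancel, rbit_eq_one_iff, floor_add_zpow_div_self]
    omega
  · exact (rbit_add_zpow hxj (by omega)).symm

theorem measurableSet_floor_emod_two (j r : ℤ) :
    MeasurableSet {x : ℝ | ⌊x / (2:ℝ) ^ j⌋ % 2 = r} :=
  (Int.measurable_floor.comp (measurable_id.div_const _))
    (MeasurableSet.of_discrete (s := {n : ℤ | n % 2 = r}))

/-- If adding the binary digit `2 ^ j` flips the sign of `f`, then `f` has integral zero over any
dyadic interval of length larger than `2 ^ j`. -/
theorem setIntegral_dyadic_eq_zero {f : ℝ → ℂ} (l : ℕ) {j k : ℤ} (hjk : j < k)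
    (hf : ∀ x, 0 ≤ x → ⌊x / (2:ℝ) ^ j⌋ % 2 = 0 → f (x + 2 ^ j) = -f x) :
    ∫ x in Set.Ico ((l : ℝ) * 2 ^ k) ((l + 1 : ℝ) * 2 ^ k), f x = 0 := by
  set I := Set.Ico ((l : ℝ) * 2 ^ k) ((l + 1 : ℝ) * 2 ^ k) with hI
  set A := {x : ℝ | ⌊x / (2:ℝ) ^ j⌋ % 2 = 0} with hA
  have hAm : MeasurableSet A := measurableSet_floor_emod_two j 0
  have hIm : MeasurableSet I := measurableSet_Ico
  by_cases hint : IntegrableOn f I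
  swap
  · exact integral_undef hint
  have hshift : ∫ x in I \ A, f x = ∫ x in I ∩ A, f (x + 2 ^ j) := by
    rw [← integral_indicator (hIm.diff hAm), ← integral_indicator (hIm.inter hAm),
      ← integral_add_right_eq_self _ ((2:ℝ) ^ j)]
    congr 1
    ext x
    have hiff : x + 2 ^ j ∈ I \ A ↔ x ∈ I ∩ A := by
      rw [mem_sdiff, mem_inter_iff, hI, mem_dyadic_Ico_iff, mem_dyadic_Ico_iff, hA, mem_ofPred_eq,
        mem_ofPred_eq, floor_add_zpow_div_self]
      constructor
      · rintro ⟨h1, h2⟩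
        have h3 : ⌊x / (2:ℝ) ^ j⌋ % 2 = 0 := by omega
        rw [floor_add_zpow_div_of_lt h3 hjk] at h1
        exact ⟨h1, h3⟩
      · rintro ⟨h1, h3⟩
        rw [floor_add_zpow_div_of_lt h3 hjk]
        exact ⟨h1, by omega⟩
    by_cases hx : x ∈ I ∩ A
    · rw [indicator_of_mem hx, indicator_of_mem (hiff.2 hx)]
    · rw [indicator_of_notMem hx, indicator_of_notMem (fun h => hx (hiff.1 h))]
  rw [← integral_inter_add_sdiff hAm hint, hshift,
    setIntegral_congr_fun (f := fun x => f (x + 2 ^ j)) (g := fun x => -f x) (hIm.inter hAm),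
    integral_neg, add_neg_cancel]
  rintro x ⟨hx, hxA⟩
  exact hf x (le_trans (by positivity) hx.1) hxA

theorem dprodDigit_eq_of_floor_eq {x x' y : ℝ} {k : ℤ} (hy : 0 ≤ y) (hyk : y < (2 ^ k)⁻¹)
    (h : ⌊x / (2:ℝ) ^ k⌋ = ⌊x' / (2:ℝ) ^ k⌋) : dprodDigit x y (-1) = dprodDigit x' y (-1) := by
  have hfl : ∀ i, k ≤ i → ⌊x / (2:ℝ) ^ i⌋ = ⌊x' / (2:ℝ) ^ i⌋ := by
    intro i hi
    induction i, hi using Int.leInduction with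
    | base => exact h
    | succ i hi ih => rw [floor_div_zpow_succ, floor_div_zpow_succ, ih]
  rw [← zpow_neg] at hyk
  unfold dprodDigit
  congr 2
  ext i
  refine and_congr_left fun hi => ?_
  have hki : k ≤ i := by
    by_contra! hik
    have := rbit_eq_zero_of_lt_zpow hy hyk (i := -1 - i) (by omega)
    omega
  rw [rbit_eq_one_iff, rbit_eq_one_iff, hfl i hki]

theorem walshTransform_indicator_eq {l : ℕ} {k : ℤ} {y : ℝ} (hy : 0 ≤ y) :
    walshTransform ((Set.Ico ((l : ℝ) * 2 ^ k) ((l + 1 : ℝ) * 2 ^ k)).indicator 1) y =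
      ∫ x in Set.Ico ((l : ℝ) * 2 ^ k) ((l + 1 : ℝ) * 2 ^ k), (-1 : ℂ) ^ dprodDigit x y (-1) := by
  have hsub : Set.Ico ((l : ℝ) * 2 ^ k) ((l + 1 : ℝ) * 2 ^ k) ⊆ Set.Ici 0 :=
    fun x hx => le_trans (by positivity) hx.1
  have hmul : ∀ x, (eW (dprod x y) : ℂ) *
      (Set.Ico ((l : ℝ) * 2 ^ k) ((l + 1 : ℝ) * 2 ^ k)).indicator 1 x =
      (Set.Ico ((l : ℝ) * 2 ^ k) ((l + 1 : ℝ) * 2 ^ k)).indicator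
        (fun x => (eW (dprod x y) : ℂ)) x := by
    intro x
    simp [indicator_apply]
  rw [walshTransform]
  simp_rw [hmul]
  rw [setIntegral_indicator measurableSet_Ico, inter_eq_self_of_subset_right hsub]
  refine setIntegral_congr_ae measurableSet_Ico ?_
  filter_upwards [ae_eW_dprod hy] with x hx hxI
  rw [hx (hsub hxI)]
  push_cast
  rfl

/-- For a dyadic interval `I = [l·2^k, (l+1)·2^k) ⊆ [0,∞)` and any `x_I ∈ I`,
`F_W(1_I)(y) = |I| · 1_{[0,|I|⁻¹]}(y) · e_W(x_I ⊗ y)` for almost every `y ≥ 0`. -/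
theorem walshTransform_indicator_dyadic_interval (l : ℕ) (k : ℤ)
    (xI : ℝ) (hxI : xI ∈ Set.Ico ((l : ℝ) * 2 ^ k) ((l + 1 : ℝ) * 2 ^ k)) :
    ∀ᵐ y ∂(volume.restrict (Set.Ici (0:ℝ))),
      walshTransform ((Set.Ico ((l : ℝ) * 2 ^ k) ((l + 1 : ℝ) * 2 ^ k)).indicator 1) y =
        ((2:ℝ) ^ k : ℝ) * (Set.Icc (0:ℝ) (((2:ℝ) ^ k)⁻¹)).indicator 1 y *
          (eW (dprod xI y) : ℝ) := by
  have hxI0 : 0 ≤ xI := le_trans (by positivity) hxI.1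
  rw [ae_restrict_iff' measurableSet_Ici]
  filter_upwards [(countable_dprodDigit_eq_one hxI0 (-1)).ae_notMem volume,
    (Set.countable_singleton (((2:ℝ) ^ k)⁻¹)).ae_notMem volume] with y hyB hyk hy
  have hy0 : 0 ≤ y := hy
  rw [walshTransform_indicator_eq hy0, eW_dprod hxI0 hy0 fun h => hyB ⟨hy0, h⟩]
  rcases lt_or_gt_of_ne hyk with hlt | hgt
  · rw [setIntegral_congr_fun (g := fun _ => (-1 : ℂ) ^ dprodDigit xI y (-1)) measurableSet_Ico,
      setIntegral_const, indicator_of_mem (mem_Icc.2 ⟨hy0, hlt.le⟩), Measure.real, Real.volume_Ico,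
      ENNReal.toReal_ofReal (by rw [← sub_mul]; ring_nf; positivity)]
    · rw [← sub_mul, add_sub_cancel_left, one_mul]
      simp
    · intro x hx
      rw [mem_dyadic_Ico_iff] at hx hxI
      simp only
      rw [dprodDigit_eq_of_floor_eq hy0 hlt (hx.trans hxI.symm)]
  · rw [indicator_of_notMem fun h => absurd h.2 (not_le.2 hgt), mul_zero, zero_mul]
    obtain ⟨m, hm, -, hym⟩ := exists_leading_rbit (lt_trans (by positivity) hgt)
    have hkm : -k < m + 1 := by
      rw [← zpow_neg] at hgt
      exact (zpow_lt_zpow_iff_right₀ one_lt_two).1 (hgt.trans hm)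
    refine setIntegral_dyadic_eq_zero (j := -1 - m) l (by omega) fun x hx hxj => ?_
    have hsum := dprodDigit_add_zpow (k := -1) hx hy0 hxj (by rwa [sub_sub_cancel])
    rcases Nat.le_one_iff_eq_zero_or_eq_one.1 (dprodDigit_le_one x y (-1)) with h | h
    · rw [h, show dprodDigit (x + 2 ^ (-1 - m)) y (-1) = 1 by omega]
      simp
    · rw [h, show dprodDigit (x + 2 ^ (-1 - m)) y (-1) = 0 by omega]
      simp

end
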